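/- (Jacobi–Anger expansion, cosine part.) For every w ∈ ℝ and y ∈ ℝ, cos(w · sin(y)) = ∑_{m ∈ ℤ} J_{2m}(w) · cos(2m·y), the family over m ∈ ℤ being summable. -/

import Mathlib

/-- Bessel function of the first kind of natural order `k`. -/
noncomputable def besselJNat (k : ℕ) (x : ℝ) : ℝ :=
  ∑' m : ℕ, (-1 : ℝ) ^ m / (Nat.factorial m * Nat.factorial (m + k)) * (x / 2) ^ (2 * m + k)

/-- Bessel function of the first kind of integer order `k`:
for `k < 0` it is defined as `(-1)^{-k} J_{-k}`. -/
noncomputable def besselJ (k : ℤ) (x : ℝ) : ℝ :=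
  if 0 ≤ k then besselJNat k.toNat x
  else (-1 : ℝ) ^ (-k).toNat * besselJNat (-k).toNat x

def jaEquiv : ℤ × ℕ ≃ ℕ × ℕ where
  toFun x := (x.2 + x.1.toNat, x.2 + (-x.1).toNat)
  invFun x := ((x.1 : ℤ) - x.2, min x.1 x.2)
  left_inv := by
    rintro ⟨n, m⟩
    ext <;> simp <;> omega
  right_inv := by
    rintro ⟨n, m⟩
    ext <;> simp <;> omega

theorem ja_prod (u v : ℂ) :
    HasSum (fun x : ℕ × ℕ => u ^ x.1 / (Nat.factorial x.1 : ℂ) * (v ^ x.2 / (Nat.factorial x.2 : ℂ)))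
      (Complex.exp (u + v)) := by
  have hu := NormedSpace.norm_expSeries_div_summable (𝔸 := ℂ) u
  have hv := NormedSpace.norm_expSeries_div_summable (𝔸 := ℂ) v
  have hs := summable_mul_of_summable_norm hu hv
  have ht := tsum_mul_tsum_of_summable_norm hu hv
  have eu := (NormedSpace.expSeries_div_hasSum_exp (𝔸 := ℂ) u).tsum_eq
  have ev := (NormedSpace.expSeries_div_hasSum_exp (𝔸 := ℂ) v).tsum_eq
  rw [eu, ev, ← Complex.exp_eq_exp_ℂ, ← Complex.exp_add] at ht
  rw [ht]
  exact hs.hasSum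

theorem ja_complex (w : ℝ) (t : ℂ) (ht : t ≠ 0) :
    HasSum (fun n : ℤ => (besselJ n w : ℂ) * t ^ n)
      (Complex.exp ((w / 2 : ℂ) * t + -((w / 2 : ℂ) * t⁻¹))) := by
  have h := (jaEquiv.hasSum_iff).mpr (ja_prod ((w / 2 : ℂ) * t) (-((w / 2 : ℂ) * t⁻¹)))
  have h2 := h.prod_fiberwise (fun n => (h.summable.prod_factor n).hasSum)
  convert h2 using 1
  funext n
  unfold besselJ besselJNat
  split_ifs with hn
  · obtain ⟨k, rfl⟩ := Int.eq_ofNat_of_zero_le hn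
    rw [Complex.ofReal_tsum, ← tsum_mul_right]
    congr 1
    funext m
    simp only [jaEquiv, Function.comp, Equiv.coe_fn_mk, Int.toNat_natCast, zpow_natCast,
      Int.toNat_neg_natCast, add_zero]
    push_cast
    rw [neg_pow (_ * _), mul_pow, mul_pow, pow_add t, inv_pow]
    field_simp
    ring
  · obtain ⟨k, hk⟩ := Int.eq_ofNat_of_zero_le (show 0 ≤ -n by omega)
    obtain rfl : n = -(k : ℤ) := by omega
    rw [Complex.ofReal_mul, Complex.ofReal_tsum, ← tsum_mul_left, ← tsum_mul_right]
    congr 1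
    funext m
    simp only [jaEquiv, Function.comp, Equiv.coe_fn_mk, neg_neg, Int.toNat_natCast, zpow_natCast,
      zpow_neg, Int.toNat_neg_natCast, add_zero]
    push_cast
    rw [neg_pow (_ * _), mul_pow, mul_pow, inv_pow, pow_add t]
    field_simp
    ring

theorem ja_real (w y : ℝ) :
    HasSum (fun n : ℤ => besselJ n w * Real.cos (n * y)) (Real.cos (w * Real.sin y)) := by
  have h := Complex.hasSum_re (ja_complex w (Complex.exp (y * Complex.I)) (Complex.exp_ne_zero _))
  convert h using 1
  · funext n
    rw [← Complex.exp_int_mul, Complex.re_ofReal_mul]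
    rw [← mul_assoc, show ((n : ℂ) * (y : ℂ)) = ((n * y : ℝ) : ℂ) by push_cast; rfl,
      Complex.exp_ofReal_mul_I_re]
  · rw [← Complex.exp_neg, ← Complex.exp_ofReal_mul_I_re]
    congr 2
    push_cast
    rw [Complex.sin, neg_mul]
    linear_combination (-(w : ℂ) / 2 * (Complex.exp (y * Complex.I) - Complex.exp (-(y * Complex.I)))) * Complex.I_sq

theorem jacobi_anger_cos (w y : ℝ) :
    Summable (fun m : ℤ => besselJ (2 * m) w * Real.cos ((2 * m) * y)) ∧
    Real.cos (w * Real.sin y) =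
      ∑' m : ℤ, besselJ (2 * m) w * Real.cos ((2 * m) * y) := by
  have h := ((ja_real w y).add (ja_real w (y + Real.pi))).div_const 2
  have hi : Function.Injective (fun m : ℤ => 2 * m) := fun a b hab => by
    simp only at hab; omega
  have hc : ∀ n : ℤ, Real.cos (n * (y + Real.pi)) = (-1) ^ n * Real.cos (n * y) := fun n => by
    rw [mul_add, Real.cos_add_int_mul_pi]
  rw [← hi.hasSum_iff] at h
  · have h3 : HasSum (fun m : ℤ => besselJ (2 * m) w * Real.cos ((2 * m) * y))
        (Real.cos (w * Real.sin y)) := by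
      convert h using 1
      · rfl
      · funext m
        simp only [Function.comp, hc, zpow_mul]
        push_cast
        norm_num
      · rw [Real.sin_add_pi, mul_neg, Real.cos_neg]; ring
    exact ⟨h3.summable, h3.tsum_eq.symm⟩
  · intro n hn
    have : Odd n := by
      rw [← Int.not_even_iff_odd]
      rintro ⟨k, hk⟩
      exact hn ⟨k, by simp only; omega⟩
    rw [hc, this.neg_one_zpow]
    ring
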